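/- For fixed x > 0, J_{ν+n}(x) Y_{ν+n}(x) = −1/(π(ν+n)) − x²/(2π(ν+n)³) + O(1/n⁴) as n → ∞ through integers; in particular there exist C and N such that |J_{ν+n}(x) Y_{ν+n}(x) + 1/(π(ν+n))| ≤ C/n³ for all n ≥ N. -/

import Mathlib

open MeasureTheory Real Filter Set Topology

noncomputable def besselJ (ν x : ℝ) : ℝ :=
  (x / 2) ^ ν * ∑' k : ℕ, (-1 : ℝ) ^ k * (x ^ 2 / 4) ^ k / (k.factorial * Real.Gamma (ν + k + 1))

noncomputable def besselY (ν x : ℝ) : ℝ :=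
  limUnder (𝓝[{μ : ℝ | ∀ n : ℤ, μ ≠ (n : ℝ)}] ν)
    (fun μ => (besselJ μ x * Real.cos (μ * Real.pi) - besselJ (-μ) x) / Real.sin (μ * Real.pi))


/-- The entire function `s ↦ ∑ₖ zᵏ / (k! Γ(s + k + 1))`. -/
noncomputable def besselSeries (z s : ℂ) : ℂ :=
  ∑' k : ℕ, z ^ k / (k.factorial * Complex.Gamma (s + k + 1))

/-- The Bessel function `J` at a real argument `x` and complex order `s`. -/
noncomputable def complexBesselJ (x : ℝ) (s : ℂ) : ℂ :=
  ((x / 2 : ℝ) : ℂ) ^ s * besselSeries (-(x ^ 2 / 4 : ℝ)) s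

theorem exists_norm_Gamma_inv_le_div_factorial (R : ℝ) :
    ∃ M : ℝ, 0 ≤ M ∧ ∃ K : ℕ, ∀ s : ℂ, ‖s‖ ≤ R → ∀ m : ℕ,
      ‖(Complex.Gamma (s + K + m))⁻¹‖ ≤ M / m.factorial := by
  obtain ⟨K, hK⟩ := exists_nat_ge (R + 1)
  have hcont : Continuous fun s : ℂ => (Complex.Gamma (s + K))⁻¹ :=
    Complex.differentiable_one_div_Gamma.continuous.comp (by fun_prop)
  obtain ⟨M, hM⟩ := (isCompact_closedBall (0 : ℂ) R).exists_bound_of_continuousOn hcont.continuousOn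
  refine ⟨max M 0, le_max_right _ _, K, fun s hs m => ?_⟩
  induction m with
  | zero => simpa using Or.inl (hM s (by simpa using hs))
  | succ m ih =>
    have h1 : (m : ℝ) + 1 ≤ ‖s + K + m‖ := by
      have h2 : ‖((K + m : ℕ) : ℂ)‖ - ‖-s‖ ≤ ‖((K + m : ℕ) : ℂ) - -s‖ := norm_sub_norm_le _ _
      rw [Complex.norm_natCast, norm_neg] at h2
      have h3 : ((K + m : ℕ) : ℂ) - -s = s + K + m := by push_cast; ring
      rw [h3] at h2
      push_cast at h2
      linarith
    have h0 : s + K + m ≠ 0 := by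
      intro h
      rw [h, norm_zero] at h1
      have : (0 : ℝ) ≤ m := m.cast_nonneg
      linarith
    have h4 : s + K + ((m + 1 : ℕ) : ℂ) = s + K + m + 1 := by push_cast; ring
    rw [h4, Complex.Gamma_add_one _ h0, mul_inv, norm_mul, norm_inv, Nat.factorial_succ]
    push_cast
    calc ‖s + K + m‖⁻¹ * ‖(Complex.Gamma (s + K + m))⁻¹‖
        ≤ ((m : ℝ) + 1)⁻¹ * (max M 0 / m.factorial) := by gcongr
      _ = max M 0 / ((m + 1) * m.factorial) := by field_simp

theorem exists_norm_Gamma_inv_le (R : ℝ) :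
    ∃ M : ℝ, ∀ k : ℕ, ∀ s : ℂ, ‖s‖ ≤ R → ‖(Complex.Gamma (s + k + 1))⁻¹‖ ≤ M := by
  obtain ⟨M, hM0, K, hM⟩ := exists_norm_Gamma_inv_le_div_factorial R
  have hcont (k : ℕ) : Continuous fun s : ℂ => (Complex.Gamma (s + k + 1))⁻¹ :=
    Complex.differentiable_one_div_Gamma.continuous.comp (by fun_prop)
  choose B hB using fun k => (isCompact_closedBall (0 : ℂ) R).exists_bound_of_continuousOn
    (hcont k).continuousOn
  refine ⟨M + ∑ k ∈ Finset.range K, |B k|, fun k s hs => ?_⟩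
  rcases lt_or_ge k K with hk | hk
  · calc _ ≤ B k := hB k s (by simpa using hs)
      _ ≤ |B k| := le_abs_self _
      _ ≤ ∑ k ∈ Finset.range K, |B k| :=
        Finset.single_le_sum (f := fun k => |B k|) (fun i _ => abs_nonneg _) (by simpa using hk)
      _ ≤ _ := by linarith
  · obtain ⟨m, rfl⟩ := Nat.exists_eq_add_of_le hk
    have h := hM s hs (m + 1)
    have h1 : s + K + ((m + 1 : ℕ) : ℂ) = s + ((K + m : ℕ) : ℂ) + 1 := by push_cast; ring
    rw [h1] at h
    have h2 : M / ((m + 1).factorial : ℝ) ≤ M :=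
      div_le_self hM0 (by exact_mod_cast (m + 1).factorial_pos)
    have h3 : 0 ≤ ∑ k ∈ Finset.range K, |B k| := Finset.sum_nonneg fun i _ => abs_nonneg _
    linarith

theorem norm_besselSeries_term (z s : ℂ) (k : ℕ) :
    ‖z ^ k / (k.factorial * Complex.Gamma (s + k + 1))‖ =
      ‖z‖ ^ k / k.factorial * ‖(Complex.Gamma (s + k + 1))⁻¹‖ := by
  rw [norm_div, norm_mul, norm_pow, Complex.norm_natCast, norm_inv]
  ring

theorem summable_norm_besselSeries (z s : ℂ) :
    Summable fun k : ℕ => ‖z ^ k / (k.factorial * Complex.Gamma (s + k + 1))‖ := by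
  obtain ⟨M, hM⟩ := exists_norm_Gamma_inv_le ‖s‖
  refine Summable.of_nonneg_of_le (fun _ => norm_nonneg _) (fun k => ?_)
    ((Real.summable_pow_div_factorial ‖z‖).mul_right M)
  rw [norm_besselSeries_term]
  gcongr
  exact hM k s le_rfl

theorem differentiable_besselSeries (z : ℂ) : Differentiable ℂ (besselSeries z) := by
  intro s
  obtain ⟨M, hM⟩ := exists_norm_Gamma_inv_le (‖s‖ + 1)
  have h : DifferentiableOn ℂ (besselSeries z) (Metric.ball 0 (‖s‖ + 1)) := by
    refine Complex.differentiableOn_tsum_of_summable_norm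
      ((Real.summable_pow_div_factorial ‖z‖).mul_right M) (fun k => ?_) Metric.isOpen_ball
      (fun k w hw => ?_)
    · have h1 : Differentiable ℂ fun s : ℂ => (Complex.Gamma (s + k + 1))⁻¹ :=
        Complex.differentiable_one_div_Gamma.comp (by fun_prop)
      have h2 := h1.const_mul (z ^ k / (k.factorial : ℂ))
      refine Differentiable.differentiableOn ?_
      have h3 : (fun w : ℂ => z ^ k / (k.factorial * Complex.Gamma (w + k + 1))) =
          fun w => z ^ k / (k.factorial : ℂ) * (Complex.Gamma (w + k + 1))⁻¹ := by
        funext w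
        rw [← div_div, div_eq_mul_inv (z ^ k / _)]
      rw [h3]
      exact h2
    · rw [norm_besselSeries_term]
      gcongr
      exact hM k w (by simpa using (mem_ball_zero_iff.1 hw).le)
  exact h.differentiableAt (Metric.isOpen_ball.mem_nhds (by simp))

theorem differentiable_complexBesselJ {x : ℝ} (hx : 0 < x) :
    Differentiable ℂ (complexBesselJ x) := by
  have h0 : ((x / 2 : ℝ) : ℂ) ≠ 0 := by exact_mod_cast (half_pos hx).ne'
  intro s
  exact (differentiableAt_id.const_cpow (Or.inl h0)).mul (differentiable_besselSeries _ s)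

theorem ofReal_besselJ {x : ℝ} (hx : 0 < x) (μ : ℝ) :
    ((besselJ μ x : ℝ) : ℂ) = complexBesselJ x μ := by
  rw [besselJ, complexBesselJ, besselSeries, Complex.ofReal_mul,
    Complex.ofReal_cpow (half_pos hx).le, Complex.ofReal_tsum]
  congr 2
  funext k
  push_cast
  rw [← Complex.Gamma_ofReal, neg_pow ((x : ℂ) ^ 2 / 4)]
  push_cast
  rfl

theorem Gamma_inv_eq_descPochhammer_mul (j : ℕ) (s : ℂ) :
    (Complex.Gamma (s + 1))⁻¹ =
      (descPochhammer ℤ j).smeval (s + j) * (Complex.Gamma (s + j + 1))⁻¹ := by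
  induction j generalizing s with
  | zero => simp
  | succ j ih =>
    have h := Complex.one_div_Gamma_eq_self_mul_one_div_Gamma_add_one (s + 1)
    have e : s + ((j + 1 : ℕ) : ℂ) = s + 1 + j := by push_cast; ring
    rw [h, ih (s + 1), e, descPochhammer_succ_right, Polynomial.smeval_mul,
      Polynomial.smeval_sub, Polynomial.smeval_X, Polynomial.smeval_natCast]
    simp
    ring

theorem inv_factorial_mul_Gamma (j : ℕ) (s : ℂ) :
    ((j.factorial : ℂ) * Complex.Gamma (s + 1))⁻¹ =
      Ring.choose (s + j) j * (Complex.Gamma (s + j + 1))⁻¹ := by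
  rw [mul_inv, Gamma_inv_eq_descPochhammer_mul j s, Ring.choose_eq_smul, smul_eq_mul]
  ring

theorem besselSeries_mul_besselSeries_neg (z s : ℂ) :
    HasSum (fun k : ℕ => z ^ k * k.centralBinom *
        (Complex.Gamma (s + k + 1) * Complex.Gamma (-s + k + 1))⁻¹)
      (besselSeries z s * besselSeries z (-s)) := by
  have key (k : ℕ) : ∑ ij ∈ Finset.HasAntidiagonal.antidiagonal k,
      z ^ ij.1 / (ij.1.factorial * Complex.Gamma (s + ij.1 + 1)) *
        (z ^ ij.2 / (ij.2.factorial * Complex.Gamma (-s + ij.2 + 1))) =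
      z ^ k * k.centralBinom * (Complex.Gamma (s + k + 1) * Complex.Gamma (-s + k + 1))⁻¹ := by
    have hc : (k.centralBinom : ℂ) = ∑ ij ∈ Finset.HasAntidiagonal.antidiagonal k,
        Ring.choose (-s + k) ij.1 * Ring.choose (s + k) ij.2 := by
      rw [← Ring.add_choose_eq k (Commute.all _ _), Nat.centralBinom_eq_two_mul_choose,
        ← Ring.choose_natCast]
      congr 1
      push_cast
      ring
    rw [hc, Finset.mul_sum, Finset.sum_mul]
    refine Finset.sum_congr rfl fun ij hij => ?_
    obtain ⟨i, j⟩ := ij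
    rw [Finset.HasAntidiagonal.mem_antidiagonal] at hij
    simp only at hij ⊢
    subst hij
    have h1 := inv_factorial_mul_Gamma j (s + i)
    have h2 := inv_factorial_mul_Gamma i (-s + j)
    have e1 : s + ((i + j : ℕ) : ℂ) = s + i + j := by push_cast; ring
    have e2 : -s + ((i + j : ℕ) : ℂ) = -s + j + i := by push_cast; ring
    rw [e1, e2]
    rw [mul_inv] at h1 h2 ⊢
    rw [pow_add, div_eq_mul_inv, div_eq_mul_inv, mul_inv, mul_inv]
    linear_combination z ^ i * z ^ j * (i.factorial : ℂ)⁻¹ * (Complex.Gamma (-s + j + 1))⁻¹ * h1 +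
      z ^ i * z ^ j * (Ring.choose (s + i + j) j * (Complex.Gamma (s + i + j + 1))⁻¹) * h2
  have hs := summable_norm_sum_mul_antidiagonal_of_summable_norm
    (summable_norm_besselSeries z s) (summable_norm_besselSeries z (-s))
  have ht := tsum_mul_tsum_eq_tsum_sum_antidiagonal_of_summable_norm
    (summable_norm_besselSeries z s) (summable_norm_besselSeries z (-s))
  simp only [key] at hs ht
  rw [besselSeries, besselSeries, ht]
  exact hs.of_norm.hasSum

theorem sin_pi_mul_natCast_add_eq_zero {s : ℂ} {n : ℕ} (h : s + n = 0 ∨ -s + n = 0) :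
    Complex.sin (π * s) = 0 := by
  rw [Complex.sin_eq_zero_iff]
  rcases h with h | h
  · refine ⟨-n, ?_⟩
    push_cast
    linear_combination (π : ℂ) * h
  · refine ⟨n, ?_⟩
    push_cast
    linear_combination -(π : ℂ) * h

theorem Gamma_mul_Gamma_neg (k : ℕ) {s : ℂ} (hs : Complex.sin (π * s) ≠ 0) :
    Complex.Gamma (s + k + 1) * Complex.Gamma (-s + k + 1) =
      (-1) ^ k * (∏ j ∈ Finset.range k, (s ^ 2 - (j + 1) ^ 2)) *
        (π * s / Complex.sin (π * s)) := by
  induction k with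
  | zero =>
    have h0 : s ≠ 0 := by
      rintro rfl
      simp at hs
    have h := Complex.Gamma_mul_Gamma_one_sub s
    have e : -s + ((0 : ℕ) : ℂ) + 1 = 1 - s := by push_cast; ring
    rw [e]
    simp only [CharP.cast_eq_zero, add_zero, pow_zero, Finset.range_zero, Finset.prod_empty]
    rw [Complex.Gamma_add_one s h0]
    linear_combination s * h
  | succ k ih =>
    have h1 : s + k + 1 ≠ 0 := fun h =>
      hs (sin_pi_mul_natCast_add_eq_zero (n := k + 1) (Or.inl (by push_cast; rw [← h]; ring)))
    have h2 : -s + k + 1 ≠ 0 := fun h =>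
      hs (sin_pi_mul_natCast_add_eq_zero (n := k + 1) (Or.inr (by push_cast; rw [← h]; ring)))
    have e1 : s + ((k + 1 : ℕ) : ℂ) + 1 = s + k + 1 + 1 := by push_cast; ring
    have e2 : -s + ((k + 1 : ℕ) : ℂ) + 1 = -s + k + 1 + 1 := by push_cast; ring
    rw [e1, e2, Complex.Gamma_add_one _ h1, Complex.Gamma_add_one _ h2, Finset.prod_range_succ]
    linear_combination (s + k + 1) * (-s + k + 1) * ih

theorem hasSum_complexBesselJ_mul_neg {x : ℝ} (hx : 0 < x) {s : ℂ}
    (hs : Complex.sin (π * s) ≠ 0) :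
    HasSum (fun k : ℕ => ((x : ℂ) ^ 2 / 4) ^ k * k.centralBinom /
        ∏ j ∈ Finset.range k, (s ^ 2 - (j + 1) ^ 2))
      (complexBesselJ x s * complexBesselJ x (-s) * (π * s / Complex.sin (π * s))) := by
  have h0 : s ≠ 0 := by
    rintro rfl
    simp at hs
  have hpi : (π : ℂ) ≠ 0 := by exact_mod_cast Real.pi_ne_zero
  have hc : (π * s / Complex.sin (π * s)) ≠ 0 := div_ne_zero (mul_ne_zero hpi h0) hs
  have h := (besselSeries_mul_besselSeries_neg (-(x ^ 2 / 4 : ℝ)) s).mul_right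
    (π * s / Complex.sin (π * s))
  have hx2 : ((x / 2 : ℝ) : ℂ) ≠ 0 := by exact_mod_cast (half_pos hx).ne'
  have hpow : ((x / 2 : ℝ) : ℂ) ^ s * ((x / 2 : ℝ) : ℂ) ^ (-s) = 1 := by
    rw [← Complex.cpow_add _ _ hx2, add_neg_cancel, Complex.cpow_zero]
  have e : complexBesselJ x s * complexBesselJ x (-s) =
      besselSeries (-(x ^ 2 / 4 : ℝ)) s * besselSeries (-(x ^ 2 / 4 : ℝ)) (-s) := by
    rw [complexBesselJ, complexBesselJ]
    linear_combination besselSeries (-(x ^ 2 / 4 : ℝ)) s *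
      besselSeries (-(x ^ 2 / 4 : ℝ)) (-s) * hpow
  rw [e]
  refine Eq.mpr (congrArg (HasSum · _) (funext fun k => ?_)) h
  rw [Gamma_mul_Gamma_neg k hs, mul_inv, mul_inv, mul_assoc _ _ (π * s / Complex.sin (π * s)),
    inv_mul_cancel_right₀ hc, neg_pow, div_eq_mul_inv]
  have h1 : (-1 : ℂ) ^ k * ((-1) ^ k)⁻¹ = 1 := mul_inv_cancel₀ (by simp)
  push_cast
  linear_combination -((x : ℂ) ^ 2 / 4) ^ k * k.centralBinom *
    (∏ j ∈ Finset.range k, (s ^ 2 - ((j : ℂ) + 1) ^ 2))⁻¹ * h1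

theorem norm_sq_sub_ge {s a : ℂ} (ha : 2 * ‖a‖ ≤ ‖s‖ ^ 2) : ‖s‖ ^ 2 / 2 ≤ ‖s ^ 2 - a‖ := by
  have h := norm_sub_norm_le (s ^ 2) a
  rw [norm_pow] at h
  linarith

theorem norm_prod_sq_sub_ge {s : ℂ} {δ : ℝ} (hδ : 0 < δ) (hre : 0 ≤ s.re) (hs : 4 ≤ ‖s‖)
    (hd : ∀ j : ℕ, δ ≤ ‖s - j‖) (k : ℕ) :
    ‖s‖ ^ 4 / 4 * δ ^ k * k.factorial ≤
      ‖∏ j ∈ Finset.range (k + 2), (s ^ 2 - ((j : ℂ) + 1) ^ 2)‖ := by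
  induction k with
  | zero =>
    have h16 : 16 ≤ ‖s‖ ^ 2 := by nlinarith
    have h1 : ‖s‖ ^ 2 / 2 ≤ ‖s ^ 2 - (((0 : ℕ) : ℂ) + 1) ^ 2‖ :=
      norm_sq_sub_ge (by norm_num; linarith)
    have h2 : ‖s‖ ^ 2 / 2 ≤ ‖s ^ 2 - (((1 : ℕ) : ℂ) + 1) ^ 2‖ :=
      norm_sq_sub_ge (by norm_num; linarith)
    rw [Finset.prod_range_succ, Finset.prod_range_one, norm_mul]
    calc _ = ‖s‖ ^ 2 / 2 * (‖s‖ ^ 2 / 2) := by simp; ring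
      _ ≤ _ := by gcongr
  | succ k ih =>
    rw [show k + 1 + 2 = (k + 2) + 1 from rfl, Finset.prod_range_succ, norm_mul]
    have e : s ^ 2 - (((k + 2 : ℕ) : ℂ) + 1) ^ 2 =
        (s - ((k + 3 : ℕ) : ℂ)) * (s + ((k + 3 : ℕ) : ℂ)) := by push_cast; ring
    have h1 : ((k + 1 : ℕ) : ℝ) ≤ ‖s + ((k + 3 : ℕ) : ℂ)‖ := by
      refine le_trans ?_ (Complex.re_le_norm _)
      rw [Complex.add_re, Complex.natCast_re]
      push_cast
      linarith
    rw [e, norm_mul, pow_succ, Nat.factorial_succ, Nat.cast_mul]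
    calc _ = ‖s‖ ^ 4 / 4 * δ ^ k * k.factorial * (δ * ((k + 1 : ℕ) : ℝ)) := by ring
      _ ≤ _ := by
        gcongr
        exact hd _

theorem exists_norm_complexBesselJ_mul_neg_le {x : ℝ} (hx : 0 < x) {δ : ℝ} (hδ : 0 < δ) :
    ∃ C : ℝ, ∀ s : ℂ, Complex.sin (π * s) ≠ 0 → 0 ≤ s.re → 4 ≤ ‖s‖ →
      (∀ j : ℕ, δ ≤ ‖s - j‖) →
      ‖complexBesselJ x s * complexBesselJ x (-s) / Complex.sin (π * s) -
        (1 / (π * s) + x ^ 2 / (2 * π * s ^ 3))‖ ≤ C / ‖s‖ ^ 4 := by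
  set y : ℝ := x ^ 2 / 4 with hy
  have hy0 : 0 < y := by positivity
  refine ⟨64 * y ^ 2 * Real.exp (4 * y / δ) + x ^ 2, fun s hsin hre hs hd => ?_⟩
  have hs0 : s ≠ 0 := by
    rintro rfl
    simp at hsin
  have hn0 : 0 < ‖s‖ := norm_pos_iff.2 hs0
  have hpi : (π : ℂ) ≠ 0 := by exact_mod_cast Real.pi_ne_zero
  have hsum := hasSum_complexBesselJ_mul_neg hx hsin
  set T : ℕ → ℂ := fun k => ((x : ℂ) ^ 2 / 4) ^ k * k.centralBinom /
    ∏ j ∈ Finset.range k, (s ^ 2 - ((j : ℂ) + 1) ^ 2) with hT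
  have hterm (k : ℕ) : ‖T (k + 2)‖ ≤
      64 * y ^ 2 / ‖s‖ ^ 4 * ((4 * y / δ) ^ k / k.factorial) := by
    have hb : ((k + 2).centralBinom : ℝ) ≤ 4 ^ (k + 2) := by
      have h : (k + 2).centralBinom ≤ 2 ^ (2 * (k + 2)) := Nat.choose_le_two_pow _ _
      rw [pow_mul] at h
      exact_mod_cast h
    have hyx : ‖(x : ℂ) ^ 2 / 4‖ = y := by
      rw [norm_div, norm_pow, Complex.norm_real, Real.norm_eq_abs, sq_abs]
      norm_num [hy]
    have hp := norm_prod_sq_sub_ge hδ hre hs hd k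
    have hfac : (0 : ℝ) < k.factorial := by exact_mod_cast k.factorial_pos
    rw [hT]
    simp only
    rw [norm_div, norm_mul, norm_pow, hyx, Complex.norm_natCast]
    calc _ ≤ y ^ (k + 2) * 4 ^ (k + 2) / (‖s‖ ^ 4 / 4 * δ ^ k * k.factorial) := by gcongr
      _ = _ := by
        rw [div_pow (4 * y), mul_pow 4 y]
        field_simp
        ring
  have hsumm : Summable fun k : ℕ =>
      64 * y ^ 2 / ‖s‖ ^ 4 * ((4 * y / δ) ^ k / k.factorial) :=
    (Real.summable_pow_div_factorial _).mul_left _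
  have htail : ‖∑' k, T (k + 2)‖ ≤ 64 * y ^ 2 * Real.exp (4 * y / δ) / ‖s‖ ^ 4 := by
    refine (tsum_of_norm_bounded hsumm.hasSum hterm).trans (le_of_eq ?_)
    rw [tsum_mul_left, Real.exp_eq_exp_ℝ, NormedSpace.exp_eq_tsum_div]
    ring
  have hsplit := hsum.summable.sum_add_tsum_nat_add 2
  rw [hsum.tsum_eq, Finset.sum_range_succ, Finset.sum_range_one] at hsplit
  have h16 : 16 ≤ ‖s‖ ^ 2 := by nlinarith
  have h1 : ‖s‖ ^ 2 / 2 ≤ ‖s ^ 2 - 1‖ := norm_sq_sub_ge (by norm_num; linarith)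
  have hs1 : s ^ 2 - 1 ≠ 0 := norm_pos_iff.1 (by linarith)
  have hT0 : T 0 = 1 := by simp [hT]
  have hT1 : T 1 = x ^ 2 / (2 * (s ^ 2 - 1)) := by
    have hc : Nat.centralBinom 1 = 2 := rfl
    simp only [hT, pow_one, hc, Finset.prod_range_one]
    push_cast
    rw [zero_add, one_pow]
    field_simp
    ring
  rw [hT0, hT1] at hsplit
  have hJ : complexBesselJ x s * complexBesselJ x (-s) / Complex.sin (π * s) -
      (1 / (π * s) + x ^ 2 / (2 * π * s ^ 3)) =
      (∑' k, T (k + 2) + x ^ 2 / (2 * s ^ 2 * (s ^ 2 - 1))) / (π * s) := by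
    have e : complexBesselJ x s * complexBesselJ x (-s) / Complex.sin (π * s) =
        complexBesselJ x s * complexBesselJ x (-s) * (π * s / Complex.sin (π * s)) / (π * s) := by
      field_simp
    rw [e, ← hsplit]
    field_simp
    ring
  have h2 : ‖(x : ℂ) ^ 2 / (2 * s ^ 2 * (s ^ 2 - 1))‖ ≤ x ^ 2 / ‖s‖ ^ 4 := by
    rw [norm_div, norm_mul, norm_mul, norm_pow, norm_pow, Complex.norm_real, Real.norm_eq_abs,
      sq_abs, Complex.norm_two]
    refine div_le_div_of_nonneg_left (by positivity) (by positivity) ?_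
    calc ‖s‖ ^ 4 = 2 * ‖s‖ ^ 2 * (‖s‖ ^ 2 / 2) := by ring
      _ ≤ _ := by gcongr
  have h3 : 1 ≤ ‖(π : ℂ) * s‖ := by
    rw [norm_mul, Complex.norm_real, Real.norm_eq_abs, abs_of_pos Real.pi_pos]
    nlinarith [Real.pi_gt_three]
  rw [hJ, norm_div, add_div]
  exact (div_le_self (norm_nonneg _) h3).trans ((norm_add_le _ _).trans (add_le_add htail h2))

theorem exists_norm_complexBesselJ_add_natCast_le {x : ℝ} (hx : 0 < x) (R : ℝ) :
    ∃ C : ℝ, ∃ N : ℕ, ∀ n : ℕ, N ≤ n → ∀ s : ℂ, ‖s‖ ≤ R →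
      ‖complexBesselJ x (s + n)‖ ≤ C / (n : ℝ) ^ 2 := by
  obtain ⟨M, hM0, K, hM⟩ := exists_norm_Gamma_inv_le_div_factorial R
  set z : ℂ := -(x ^ 2 / 4 : ℝ) with hz
  set a : ℝ := x / 2 with ha
  have ha0 : 0 < a := half_pos hx
  refine ⟨2 * (Real.exp (|Real.log a| * R) * a ^ K * Real.exp 1 ^ K *
    Real.exp (a * Real.exp 1)) * (M * Real.exp ‖z‖), K + 1, fun n hn s hs => ?_⟩
  obtain ⟨m, rfl⟩ := Nat.exists_eq_add_of_le (Nat.le_of_succ_le hn)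
  have hn0 : (0 : ℝ) < ((K + m : ℕ) : ℝ) := by
    exact_mod_cast (Nat.succ_pos K).trans_le hn
  have hmf : (0 : ℝ) < m.factorial := by exact_mod_cast m.factorial_pos
  have hS : ‖besselSeries z (s + ((K + m : ℕ) : ℂ))‖ ≤ M / m.factorial * Real.exp ‖z‖ := by
    have hterm (k : ℕ) : ‖z ^ k / (k.factorial *
        Complex.Gamma (s + ((K + m : ℕ) : ℂ) + k + 1))‖ ≤
        M / m.factorial * (‖z‖ ^ k / k.factorial) := by
      rw [norm_besselSeries_term, mul_comm]
      have h := hM s hs (m + k + 1)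
      have e : s + K + ((m + k + 1 : ℕ) : ℂ) = s + ((K + m : ℕ) : ℂ) + k + 1 := by
        push_cast
        ring
      rw [e] at h
      have hle : (m.factorial : ℝ) ≤ (m + k + 1).factorial := by
        exact_mod_cast Nat.factorial_le (by omega)
      gcongr
      exact h.trans (by gcongr)
    refine (tsum_of_norm_bounded
      ((Real.summable_pow_div_factorial ‖z‖).mul_left _).hasSum hterm).trans (le_of_eq ?_)
    rw [tsum_mul_left, Real.exp_eq_exp_ℝ, NormedSpace.exp_eq_tsum_div]
  have hP : ‖((a : ℝ) : ℂ) ^ (s + ((K + m : ℕ) : ℂ))‖ ≤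
      Real.exp (|Real.log a| * R) * a ^ (K + m) := by
    rw [Complex.norm_cpow_eq_rpow_re_of_pos ha0, Complex.add_re, Complex.natCast_re,
      Real.rpow_add_natCast ha0.ne', Real.rpow_def_of_pos ha0]
    have hlog : Real.log a * s.re ≤ |Real.log a| * R :=
      calc Real.log a * s.re ≤ |Real.log a * s.re| := le_abs_self _
        _ = |Real.log a| * |s.re| := abs_mul _ _
        _ ≤ |Real.log a| * R := by
          gcongr
          exact (Complex.abs_re_le_norm s).trans hs
    exact mul_le_mul_of_nonneg_right (Real.exp_le_exp.2 hlog) (by positivity)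
  have hsq : ((K + m : ℕ) : ℝ) ^ 2 ≤ 2 * Real.exp 1 ^ (K + m) := by
    have h := Real.pow_div_factorial_le_exp ((K + m : ℕ) : ℝ) hn0.le 2
    rw [← Real.exp_nat_mul, mul_one]
    norm_num at h ⊢
    linarith
  have hexp : (a * Real.exp 1) ^ m / m.factorial ≤ Real.exp (a * Real.exp 1) :=
    Real.pow_div_factorial_le_exp _ (by positivity) m
  rw [complexBesselJ, norm_mul, le_div_iff₀ (by positivity)]
  calc _ ≤ Real.exp (|Real.log a| * R) * a ^ (K + m) * (M / m.factorial * Real.exp ‖z‖) *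
        (2 * Real.exp 1 ^ (K + m)) := by gcongr
    _ = 2 * (Real.exp (|Real.log a| * R) * a ^ K * Real.exp 1 ^ K *
        ((a * Real.exp 1) ^ m / m.factorial)) * (M * Real.exp ‖z‖) := by
      rw [pow_add, pow_add, mul_pow]
      ring
    _ ≤ _ := by gcongr

/-- The numerator in the definition of the Bessel function `Y`, for complex order. -/
noncomputable def complexBesselYNum (x : ℝ) (s : ℂ) : ℂ :=
  complexBesselJ x s * Complex.cos (π * s) - complexBesselJ x (-s)

theorem norm_sin_pi_mul_add_natCast (s : ℂ) (n : ℕ) :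
    ‖Complex.sin (π * (s + n))‖ = ‖Complex.sin (π * s)‖ := by
  rw [mul_add, mul_comm (π : ℂ) n, Complex.sin_antiperiodic.add_nat_mul_eq, norm_mul, norm_pow, norm_neg,
    norm_one, one_pow, one_mul]

theorem norm_cos_pi_mul_add_natCast (s : ℂ) (n : ℕ) :
    ‖Complex.cos (π * (s + n))‖ = ‖Complex.cos (π * s)‖ := by
  rw [mul_add, mul_comm (π : ℂ) n, Complex.cos_antiperiodic.add_nat_mul_eq, norm_mul, norm_pow, norm_neg,
    norm_one, one_pow, one_mul]

theorem exists_norm_bessel_product_le {x : ℝ} (hx : 0 < x) {K : Set ℂ} (hK : IsCompact K)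
    (hsin : ∀ s ∈ K, Complex.sin (π * s) ≠ 0) {δ : ℝ} (hδ : 0 < δ)
    (hd : ∀ s ∈ K, ∀ j : ℤ, δ ≤ ‖s - j‖) :
    ∃ C : ℝ, ∃ N : ℕ, ∀ n : ℕ, N ≤ n → ∀ s ∈ K,
      ‖complexBesselJ x (s + n) *
          (complexBesselYNum x (s + n) / Complex.sin (π * (s + n))) +
        (1 / (π * (s + n)) + x ^ 2 / (2 * π * (s + n) ^ 3))‖ ≤ C / (n : ℝ) ^ 4 := by
  obtain ⟨R, hR⟩ := hK.isBounded.exists_norm_le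
  obtain ⟨B, hB⟩ := hK.exists_bound_of_continuousOn
    (f := fun s : ℂ => Complex.cos (π * s) / Complex.sin (π * s))
    (ContinuousOn.div (by fun_prop) (by fun_prop) hsin)
  obtain ⟨C₁, N₁, h₁⟩ := exists_norm_complexBesselJ_add_natCast_le hx R
  obtain ⟨C₂, h₂⟩ := exists_norm_complexBesselJ_mul_neg_le hx hδ
  obtain ⟨N₂, hN₂⟩ := exists_nat_ge (2 * R)
  refine ⟨C₁ ^ 2 * |B| + |C₂| * 16, N₁ + N₂ + 8, fun n hn s hs => ?_⟩
  have hn8 : (8 : ℝ) ≤ n := by exact_mod_cast (by omega : 8 ≤ n)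
  have hnR : 2 * R ≤ n := hN₂.trans (by exact_mod_cast (by omega : N₂ ≤ n))
  have hsR := hR s hs
  have hre : (n : ℝ) / 2 ≤ (s + n).re := by
    have h := (abs_le.1 ((Complex.abs_re_le_norm s).trans hsR)).1
    rw [Complex.add_re, Complex.natCast_re]
    linarith
  have hnorm : (n : ℝ) / 2 ≤ ‖s + n‖ := hre.trans (Complex.re_le_norm _)
  have hsin' : Complex.sin (π * (s + n)) ≠ 0 := by
    rw [← norm_ne_zero_iff, norm_sin_pi_mul_add_natCast, norm_ne_zero_iff]
    exact hsin s hs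
  have hJ := h₁ n (by omega) s hsR
  have hmain := h₂ (s + n) hsin' (by linarith) (by linarith) fun j => by
    have h := hd s hs (j - n)
    have e : s - ((j - n : ℤ) : ℂ) = s + n - j := by push_cast; ring
    rwa [e] at h
  have hcot : ‖Complex.cos (π * (s + n)) / Complex.sin (π * (s + n))‖ ≤ |B| := by
    rw [norm_div, norm_sin_pi_mul_add_natCast, norm_cos_pi_mul_add_natCast, ← norm_div]
    exact (hB s hs).trans (le_abs_self B)
  have e : complexBesselJ x (s + n) *
          (complexBesselYNum x (s + n) / Complex.sin (π * (s + n))) +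
        (1 / (π * (s + n)) + x ^ 2 / (2 * π * (s + n) ^ 3)) =
      complexBesselJ x (s + n) ^ 2 * (Complex.cos (π * (s + n)) / Complex.sin (π * (s + n))) -
      (complexBesselJ x (s + n) * complexBesselJ x (-(s + n)) / Complex.sin (π * (s + n)) -
        (1 / (π * (s + n)) + x ^ 2 / (2 * π * (s + n) ^ 3))) := by
    rw [complexBesselYNum]
    ring
  rw [e]
  refine (norm_sub_le _ _).trans ?_
  rw [add_div]
  refine add_le_add ?_ (hmain.trans ?_)
  · rw [norm_mul, norm_pow]
    calc _ ≤ (C₁ / (n : ℝ) ^ 2) ^ 2 * |B| := by gcongr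
      _ = _ := by ring
  · have hn0 : (0 : ℝ) < n := by linarith
    calc C₂ / ‖s + n‖ ^ 4 ≤ |C₂| / ((n : ℝ) / 2) ^ 4 := by
          gcongr
          exact le_abs_self _
      _ = _ := by
        field_simp
        norm_num

theorem complexBesselJ_neg_natCast {x : ℝ} (hx : 0 < x) (m : ℕ) :
    complexBesselJ x (-m) = (-1) ^ m * complexBesselJ x m := by
  have hx2 : ((x / 2 : ℝ) : ℂ) ≠ 0 := by exact_mod_cast (half_pos hx).ne'
  have hS : besselSeries (-(x ^ 2 / 4 : ℝ)) (-m) =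
      (-(x ^ 2 / 4 : ℝ)) ^ m * besselSeries (-(x ^ 2 / 4 : ℝ)) m := by
    rw [besselSeries, ← (summable_norm_besselSeries _ _).of_norm.sum_add_tsum_nat_add m,
      Finset.sum_eq_zero, zero_add, besselSeries, ← tsum_mul_left]
    · refine tsum_congr fun k => ?_
      have e1 : -(m : ℂ) + ((k + m : ℕ) : ℂ) + 1 = k + 1 := by push_cast; ring
      have e2 : (m : ℂ) + k + 1 = ((k + m : ℕ) : ℂ) + 1 := by push_cast; ring
      rw [e1, e2, Complex.Gamma_nat_eq_factorial, Complex.Gamma_nat_eq_factorial, pow_add]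
      ring
    · intro k hk
      have hk' := Finset.mem_range.1 hk
      have e : -(m : ℂ) + k + 1 = -((m - 1 - k : ℕ) : ℂ) := by
        rw [Nat.sub_sub, Nat.cast_sub (by omega)]
        push_cast
        ring
      rw [e, Complex.Gamma_neg_nat_eq_zero, mul_zero, div_zero]
  rw [complexBesselJ, complexBesselJ, hS, Complex.cpow_neg, Complex.cpow_natCast]
  have h1 : (-((x ^ 2 / 4 : ℝ) : ℂ)) ^ m =
      (-1) ^ m * (((x / 2 : ℝ) : ℂ) ^ m * ((x / 2 : ℝ) : ℂ) ^ m) := by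
    rw [← mul_pow, ← mul_pow]
    push_cast
    ring
  rw [h1]
  field_simp

theorem complexBesselYNum_natCast {x : ℝ} (hx : 0 < x) (m : ℕ) :
    complexBesselYNum x m = 0 := by
  rw [complexBesselYNum, complexBesselJ_neg_natCast hx, mul_comm (π : ℂ) m]
  have h := Complex.cos_antiperiodic.add_nat_mul_eq (x := 0) m
  rw [zero_add, Complex.cos_zero, mul_one] at h
  rw [h]
  ring

theorem differentiable_complexBesselYNum {x : ℝ} (hx : 0 < x) :
    Differentiable ℂ (complexBesselYNum x) := by
  have h := differentiable_complexBesselJ hx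
  exact (h.mul (by fun_prop)).sub (h.comp differentiable_neg)

theorem sin_pi_mul_ne_zero_of_forall_ne {s : ℂ} (h : ∀ j : ℤ, s ≠ j) :
    Complex.sin (π * s) ≠ 0 :=
  sin_pi_mul_ne_zero (by rintro ⟨j, hj⟩; exact h j hj.symm)

theorem besselY_eq_re {x : ℝ} (hx : 0 < x) {c : ℝ} {q : ℂ → ℂ} (hq : ContinuousAt q c)
    (h : ∀ᶠ s in 𝓝 (c : ℂ), Complex.sin (π * s) ≠ 0 →
      q s = complexBesselYNum x s / Complex.sin (π * s)) :
    besselY c x = (q c).re := by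
  have hdense : Dense {μ : ℝ | ∀ n : ℤ, μ ≠ (n : ℝ)} := by
    convert (Set.countable_range (fun n : ℤ => (n : ℝ))).dense_compl ℝ using 1
    ext μ
    simp [eq_comm]
  have : (𝓝[{μ : ℝ | ∀ n : ℤ, μ ≠ (n : ℝ)}] c).NeBot :=
    mem_closure_iff_nhdsWithin_neBot.1 (hdense c)
  refine Filter.Tendsto.limUnder_eq ?_
  have hof : Tendsto (fun μ : ℝ => (μ : ℂ)) (𝓝[{μ : ℝ | ∀ n : ℤ, μ ≠ (n : ℝ)}] c) (𝓝 (c : ℂ)) :=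
    (Complex.continuous_ofReal.tendsto c).mono_left nhdsWithin_le_nhds
  have hre : Tendsto (fun μ : ℝ => (q μ).re) (𝓝[{μ : ℝ | ∀ n : ℤ, μ ≠ (n : ℝ)}] c)
      (𝓝 (q c).re) :=
    (Complex.continuous_re.tendsto _).comp (hq.tendsto.comp hof)
  refine hre.congr' ?_
  filter_upwards [hof.eventually h, self_mem_nhdsWithin] with μ hμ hμ'
  have hsin : Complex.sin (π * μ) ≠ 0 :=
    sin_pi_mul_ne_zero_of_forall_ne fun j hj => hμ' j (by exact_mod_cast hj)
  rw [hμ hsin, complexBesselYNum, ← ofReal_besselJ hx, ← Complex.ofReal_neg,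
    ← ofReal_besselJ hx, mul_comm (π : ℂ) μ]
  norm_cast

theorem abs_bessel_product_le {x : ℝ} (hx : 0 < x) {c : ℝ} {w : ℂ} (hY : besselY c x = w.re) :
    |besselJ c x * besselY c x + 1 / (π * c) + x ^ 2 / (2 * π * c ^ 3)| ≤
      ‖complexBesselJ x c * w + (1 / (π * c) + x ^ 2 / (2 * π * (c : ℂ) ^ 3))‖ := by
  refine le_trans (le_of_eq ?_) (Complex.abs_re_le_norm _)
  have e : (1 / (π * c) + x ^ 2 / (2 * π * (c : ℂ) ^ 3)) =
      ((1 / (π * c) + x ^ 2 / (2 * π * c ^ 3) : ℝ) : ℂ) := by push_cast; rfl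
  rw [e, ← ofReal_besselJ hx, Complex.add_re, Complex.re_ofReal_mul, Complex.ofReal_re, hY,
    add_assoc]

theorem half_le_norm_sub_intCast {p : ℤ} {s : ℂ} (hs : ‖s - p‖ = 1 / 2) (j : ℤ) :
    1 / 2 ≤ ‖s - j‖ := by
  rcases eq_or_ne j p with rfl | hj
  · exact hs.ge
  · have h1 : (1 : ℝ) ≤ ‖(p : ℂ) - j‖ := by
      rw [← Int.cast_sub, Complex.norm_intCast]
      exact_mod_cast Int.one_le_abs (sub_ne_zero.2 hj.symm)
    have h2 := norm_sub_le (s - j) (s - p)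
    rw [sub_sub_sub_cancel_left] at h2
    linarith

theorem abs_bessel_product_natCast_le {x : ℝ} (hx : 0 < x) {m : ℕ} (hm : 1 ≤ m) {B : ℝ}
    (hB : ∀ s : ℂ, ‖s - m‖ = 1 / 2 →
      ‖complexBesselJ x s * (complexBesselYNum x s / Complex.sin (π * s)) +
        (1 / (π * s) + x ^ 2 / (2 * π * s ^ 3))‖ ≤ B) :
    |besselJ m x * besselY m x + 1 / (π * m) + x ^ 2 / (2 * π * (m : ℝ) ^ 3)| ≤ B := by
  set S : ℂ → ℂ := fun s => Complex.sin (π * s) with hS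
  have hpi : (π : ℂ) ≠ 0 := by exact_mod_cast Real.pi_ne_zero
  have hSd : Differentiable ℂ S := by fun_prop
  have hSm : S m = 0 := by
    simp only [hS]
    rw [mul_comm, Complex.sin_nat_mul_pi]
  have hnum := complexBesselYNum_natCast hx m
  set q : ℂ → ℂ := fun s => dslope (complexBesselYNum x) m s / dslope S m s with hq
  have hq_eq (s : ℂ) (hs : s ≠ m) : q s = complexBesselYNum x s / S s := by
    have h0 : s - m ≠ 0 := sub_ne_zero.2 hs
    simp only [hq]
    rw [dslope_of_ne _ hs, dslope_of_ne _ hs, slope_def_field, slope_def_field, hSm, hnum,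
      sub_zero, sub_zero, div_div_div_cancel_right₀ h0]
  have hd1 : Differentiable ℂ (dslope (complexBesselYNum x) m) := fun s =>
    ((Complex.differentiableOn_dslope Filter.univ_mem).2
      (differentiable_complexBesselYNum hx).differentiableOn).differentiableAt Filter.univ_mem
  have hd2 : Differentiable ℂ (dslope S m) := fun s =>
    ((Complex.differentiableOn_dslope Filter.univ_mem).2
      hSd.differentiableOn).differentiableAt Filter.univ_mem
  have hne (s : ℂ) (hs : s ∈ Metric.closedBall (m : ℂ) (1 / 2)) : dslope S m s ≠ 0 := by
    rcases eq_or_ne s m with rfl | hsm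
    · have hder : HasDerivAt S (Complex.cos (π * m) * (π * 1)) m :=
        ((hasDerivAt_id (m : ℂ)).const_mul (π : ℂ)).csin
      rw [dslope_same, hder.deriv, mul_one]
      refine mul_ne_zero (fun hcos => ?_) hpi
      have h := Complex.sin_sq_add_cos_sq (π * m)
      have h1 : Complex.sin (π * m) = 0 := hSm
      rw [hcos, h1] at h
      norm_num at h
    · rw [dslope_of_ne _ hsm, slope_def_field, hSm, sub_zero]
      refine div_ne_zero (sin_pi_mul_ne_zero_of_forall_ne fun j hj => ?_) (sub_ne_zero.2 hsm)
      rw [mem_closedBall_iff_norm, hj] at hs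
      have hjm : j ≠ m := by
        rintro rfl
        exact hsm (by rw [hj]; norm_cast)
      have h1 : (1 : ℝ) ≤ ‖(j : ℂ) - m‖ := by
        rw [← Int.cast_natCast (R := ℂ) m, ← Int.cast_sub, Complex.norm_intCast]
        exact_mod_cast Int.one_le_abs (sub_ne_zero.2 hjm)
      linarith
  have hmball : (m : ℂ) ∈ Metric.closedBall (m : ℂ) (1 / 2) :=
    Metric.mem_closedBall_self (by norm_num)
  have hY : besselY m x = (q m).re := by
    refine besselY_eq_re hx (q := q) ?_ (Filter.Eventually.of_forall fun s hs => hq_eq s ?_)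
    · have hc : ContinuousAt q m :=
        hd1.continuous.continuousAt.div hd2.continuous.continuousAt (hne m hmball)
      exact_mod_cast hc
    · rintro rfl
      exact hs hSm
  have hs0 (s : ℂ) (hs : s ∈ Metric.closedBall (m : ℂ) (1 / 2)) : s ≠ 0 := by
    rintro rfl
    rw [mem_closedBall_iff_norm, zero_sub, norm_neg, Complex.norm_natCast] at hs
    have : (1 : ℝ) ≤ m := by exact_mod_cast hm
    linarith
  have hdiff : DifferentiableOn ℂ (fun s => complexBesselJ x s * q s +
      (1 / (π * s) + x ^ 2 / (2 * π * s ^ 3))) (Metric.closedBall (m : ℂ) (1 / 2)) := by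
    refine ((differentiable_complexBesselJ hx).differentiableOn.mul
      (hd1.differentiableOn.div hd2.differentiableOn hne)).add (DifferentiableOn.add
      (DifferentiableOn.div (by fun_prop) (by fun_prop) fun s hs => ?_)
      (DifferentiableOn.div (by fun_prop) (by fun_prop) fun s hs => ?_))
    · exact mul_ne_zero hpi (hs0 s hs)
    · exact mul_ne_zero (mul_ne_zero two_ne_zero hpi) (pow_ne_zero _ (hs0 s hs))
  have hmax := Complex.norm_le_of_forall_mem_frontier_norm_le (C := B) Metric.isBounded_ball
    (hdiff.diffContOnCl_ball subset_rfl) (fun s hs => by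
      rw [frontier_ball _ (by norm_num), mem_sphere_iff_norm] at hs
      have hsm : s ≠ m := by
        rintro rfl
        norm_num at hs
      rw [hq_eq s hsm]
      exact hB s hs) (subset_closure (Metric.mem_ball_self (x := (m : ℂ)) (by norm_num)))
  refine (abs_bessel_product_le hx hY).trans ?_
  exact_mod_cast hmax

theorem exists_abs_bessel_product_le (ν : ℝ) {x : ℝ} (hx : 0 < x) :
    ∃ C : ℝ, ∃ N : ℕ, ∀ n : ℕ, N ≤ n →
      |besselJ (ν + n) x * besselY (ν + n) x + 1 / (π * (ν + n))
          + x ^ 2 / (2 * π * (ν + n) ^ 3)| ≤ C / (n : ℝ) ^ 4 := by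
  by_cases hν : ∃ p : ℤ, ν = p
  · obtain ⟨p, rfl⟩ := hν
    obtain ⟨C, N, h⟩ := exists_norm_bessel_product_le hx (isCompact_sphere (p : ℂ) (1 / 2))
      (fun s hs => sin_pi_mul_ne_zero_of_forall_ne fun j hj => by
        have h := half_le_norm_sub_intCast (mem_sphere_iff_norm.1 hs) j
        rw [hj, sub_self, norm_zero] at h
        norm_num at h)
      one_half_pos (fun s hs j => half_le_norm_sub_intCast (mem_sphere_iff_norm.1 hs) j)
    refine ⟨C, N + p.natAbs + 1, fun n hn => ?_⟩
    obtain ⟨m, hm⟩ := Int.eq_ofNat_of_zero_le (by omega : 0 ≤ p + n)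
    have hmR : (p : ℝ) + n = m := by exact_mod_cast hm
    have hmC : (p : ℂ) + n = m := by exact_mod_cast hm
    rw [hmR]
    refine abs_bessel_product_natCast_le hx (by omega) fun s hs => ?_
    have h1 := h n (by omega) (s - n) (by
      rw [mem_sphere_iff_norm, ← hs, ← hmC]
      congr 1
      ring)
    rwa [sub_add_cancel] at h1
  · push Not at hν
    have hsin (n : ℕ) : Complex.sin (π * ((ν + n : ℝ) : ℂ)) ≠ 0 :=
      sin_pi_mul_ne_zero_of_forall_ne fun j hj => hν (j - n) (by
        have h : ν + n = j := by exact_mod_cast hj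
        push_cast
        linarith)
    obtain ⟨C, N, h⟩ := exists_norm_bessel_product_le hx (isCompact_singleton (x := (ν : ℂ)))
      (fun s hs => by
        rw [Set.mem_singleton_iff.1 hs]
        simpa using hsin 0)
      (δ := |ν - round ν|) (abs_pos.2 (sub_ne_zero.2 (hν _))) (fun s hs j => by
        rw [Set.mem_singleton_iff.1 hs]
        have e : ‖(ν : ℂ) - j‖ = |ν - j| := by
          rw [← Real.norm_eq_abs, ← Complex.norm_real]
          push_cast
          rfl
        rw [e]
        exact round_le ν j)
    refine ⟨C, N, fun n hn => ?_⟩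
    have hY := besselY_eq_re hx (c := ν + n)
      (q := fun s => complexBesselYNum x s / Complex.sin (π * s))
      (ContinuousAt.div (differentiable_complexBesselYNum hx).continuous.continuousAt
        (by fun_prop) (hsin n)) (Filter.Eventually.of_forall fun _ _ => rfl)
    have h1 := h n hn ν rfl
    have h2 := abs_bessel_product_le hx hY
    push_cast at h2
    exact h2.trans h1

theorem stmt19 (ν x : ℝ) (hx : 0 < x) :
    (∃ C : ℝ, ∃ N : ℕ, ∀ n : ℕ, N ≤ n →
      |besselJ (ν + n) x * besselY (ν + n) x + 1 / (Real.pi * (ν + n))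
          + x ^ 2 / (2 * Real.pi * (ν + n) ^ 3)| ≤ C / (n : ℝ) ^ 4) ∧
    (∃ C : ℝ, ∃ N : ℕ, ∀ n : ℕ, N ≤ n →
      |besselJ (ν + n) x * besselY (ν + n) x + 1 / (Real.pi * (ν + n))| ≤ C / (n : ℝ) ^ 3) := by
  refine ⟨exists_abs_bessel_product_le ν hx, ?_⟩
  obtain ⟨C, N, h⟩ := exists_abs_bessel_product_le ν hx
  obtain ⟨N₂, hN₂⟩ := exists_nat_ge (2 * |ν|)
  refine ⟨|C| + x ^ 2 * 8, N + N₂ + 1, fun n hn => ?_⟩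
  have hn1 : (1 : ℝ) ≤ n := by exact_mod_cast (by omega : 1 ≤ n)
  have hn0 : (0 : ℝ) < n := by linarith
  have hnν : 2 * |ν| ≤ n := hN₂.trans (by exact_mod_cast (by omega : N₂ ≤ n))
  have hhalf : (n : ℝ) / 2 ≤ ν + n := by linarith [neg_abs_le ν]
  have h1 : C / (n : ℝ) ^ 4 ≤ |C| / (n : ℝ) ^ 3 := by
    gcongr
    · exact le_abs_self C
    · norm_num
  have h2 : x ^ 2 / (2 * π * (ν + n) ^ 3) ≤ x ^ 2 * 8 / (n : ℝ) ^ 3 :=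
    calc x ^ 2 / (2 * π * (ν + n) ^ 3) ≤ x ^ 2 / (1 * ((n : ℝ) / 2) ^ 3) := by
          gcongr
          linarith [Real.pi_gt_three]
      _ = x ^ 2 * 8 / (n : ℝ) ^ 3 := by
        field_simp
        norm_num
  have h3 : 0 ≤ x ^ 2 / (2 * π * (ν + n) ^ 3) := by
    have : 0 < ν + n := by linarith
    positivity
  have h4 := abs_le.1 ((h n (by omega)).trans h1)
  rw [add_div, abs_le]
  constructor <;> linarith [h4.1, h4.2]
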